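/- The potential V cannot attain a local maximum in the exterior or on the boundary of T: if V has a local maximum at a point P (IsLocalMax V P), then P lies in the interior of T. -/

import Mathlib

open MeasureTheory

section Potential

open Set Metric Module
open scoped RealInnerProductSpace Topology

variable {E : Type*} [NormedAddCommGroup E] [InnerProductSpace ℝ E]

lemma div_le_inv_sub_inv {a b D m : ℝ} (ha : 0 < a) (hb : 0 < b) (haD : a ≤ D) (hbD : b ≤ D)
    (hm : 0 ≤ m) (h : m ≤ b ^ 2 - a ^ 2) : m / (2 * D ^ 3) ≤ a⁻¹ - b⁻¹ := by
  have hD : 0 < D := ha.trans_le haD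
  have key : a⁻¹ - b⁻¹ = (b ^ 2 - a ^ 2) / (a * b * (a + b)) := by
    field_simp
    ring
  rw [key]
  have : a * b * (a + b) ≤ D * D * (D + D) := by gcongr
  exact div_le_div₀ (hm.trans h) h (by positivity) (by linarith)

lemma neg_div_le_inv_sub_inv {a b r m : ℝ} (hr : 0 < r) (ha : r ≤ a) (hb : r ≤ b)
    (hm : 0 ≤ m) (h : -m ≤ b ^ 2 - a ^ 2) : -(m / (2 * r ^ 3)) ≤ a⁻¹ - b⁻¹ := by
  have ha' : 0 < a := hr.trans_le ha
  have hb' : 0 < b := hr.trans_le hb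
  have key : a⁻¹ - b⁻¹ = (b ^ 2 - a ^ 2) / (a * b * (a + b)) := by
    field_simp
    ring
  rw [key]
  have h₁ : r * r * (r + r) ≤ a * b * (a + b) := by gcongr
  have h₂ : m / (a * b * (a + b)) ≤ m / (2 * r ^ 3) :=
    div_le_div_of_nonneg_left hm (by positivity) (by linarith)
  have h₃ : -m / (a * b * (a + b)) ≤ (b ^ 2 - a ^ 2) / (a * b * (a + b)) := by gcongr
  rw [neg_div] at h₃
  linarith

lemma dist_sq_sub_dist_add_smul_sq {u : E} (hu : ‖u‖ = 1) (P Q : E) (t : ℝ) :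
    dist P Q ^ 2 - dist (P + t • u) Q ^ 2 = t * (2 * ⟪u, Q - P⟫ - t) := by
  have h : P + t • u - Q = t • u - (Q - P) := by abel
  rw [dist_eq_norm, dist_eq_norm, h, norm_sub_sq_real (t • u), norm_smul, hu,
    real_inner_smul_left, norm_sub_rev P, mul_one, Real.norm_eq_abs, sq_abs]
  ring

lemma inner_le_dist_of_norm_eq_one {u : E} (hu : ‖u‖ = 1) (P Q : E) : ⟪u, Q - P⟫ ≤ dist P Q := by
  simpa [hu, dist_eq_norm, norm_sub_rev] using real_inner_le_norm u (Q - P)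

section Measure

variable [FiniteDimensional ℝ E] [MeasurableSpace E] [BorelSpace E]

lemma integrableOn_inv_dist (hdim : 2 ≤ finrank ℝ E) (P : E) {s : Set E}
    (hs : Bornology.IsBounded s) : IntegrableOn (fun Q ↦ (dist P Q)⁻¹) s := by
  have : Nontrivial E := nontrivial_of_finrank_pos (R := ℝ) (by omega)
  obtain ⟨r, hr⟩ := hs.subset_ball P
  have h₀ : IntegrableOn (fun x : E ↦ ‖x‖⁻¹) (ball 0 r) := by
    refine (integrableOn_fun_norm_addHaar volume (f := fun y : ℝ ↦ y⁻¹)).2 ?_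
    have hc : IntegrableOn (fun y : ℝ ↦ y ^ (finrank ℝ E - 2)) (Ioo 0 r) :=
      ((continuous_pow _).integrableOn_Icc (a := 0) (b := r)).mono_set Ioo_subset_Icc_self
    refine hc.congr_fun (fun y hy ↦ ?_) measurableSet_Ioo
    have : finrank ℝ E - 1 = finrank ℝ E - 2 + 1 := by omega
    simp only [smul_eq_mul]
    rw [this, pow_succ, mul_assoc, mul_inv_cancel₀ hy.1.ne', mul_one]
  have h₁ := (measurePreserving_sub_right (volume : Measure E) P).integrableOn_comp_preimage
    (Homeomorph.subRight P).measurableEmbedding |>.2 h₀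
  refine (h₁.mono_set fun Q hQ ↦ ?_).congr_fun_ae (.of_forall fun Q ↦ ?_)
  · simpa [dist_eq_norm] using hr hQ
  · simp [dist_eq_norm, norm_sub_rev]

/-- The reflection in the perpendicular bisector of `P` and `P + t • u`. -/
lemma exists_measurePreserving_reflection {u : E} (hu : ‖u‖ = 1) (P : E) (t : ℝ) :
    ∃ R : E ≃ₜ E, MeasurePreserving R volume volume ∧
      ∀ Q, R Q = Q + (t - 2 * ⟪u, Q - P⟫) • u := by
  let ρ := (ℝ ∙ u)ᗮ.reflection
  refine ⟨((Homeomorph.subRight P).trans ρ.toHomeomorph).trans (Homeomorph.addRight (P + t • u)),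
    (measurePreserving_add_right volume (P + t • u)).comp
      (ρ.measurePreserving.comp (measurePreserving_sub_right volume P)), fun Q ↦ ?_⟩
  have : ρ (Q - P) = (Q - P) - (2 * ⟪u, Q - P⟫) • u := by
    rw [Submodule.reflection_orthogonal_apply, Submodule.reflection_singleton_apply]
    simp [hu, two_smul, two_mul, add_smul]
  simp only [Homeomorph.trans_apply, Homeomorph.coe_addRight, Homeomorph.subRight_apply,
    LinearIsometryEquiv.coe_toHomeomorph, this]
  module

/-- The points close to `P` that get further away when moving from `P` to `P + t • u` are
compensated by their mirror images, so only the far part of `T` matters. -/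
lemma le_setIntegral_inv_dist_sub (hdim : 2 ≤ finrank ℝ E) {T : Set E} (hT : IsCompact T)
    {P u : E} (hu : ‖u‖ = 1) (hpos : ∀ Q ∈ T, 0 ≤ ⟪u, Q - P⟫) {ε δ t D : ℝ}
    (hε : ∀ Q ∈ T, dist P Q < ε → ∀ s, 0 ≤ s → s ≤ ε → Q + s • u ∈ T)
    (ht : 0 < t) (htε : t ≤ ε / 2) (htδ : t ≤ δ)
    (hD : ∀ Q ∈ T, dist P Q ≤ D) (hD' : ∀ Q ∈ T, dist (P + t • u) Q ≤ D) :
    t * δ / (2 * D ^ 3) * volume.real (T ∩ {Q | δ < ⟪u, Q - P⟫})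
        - t ^ 2 / (2 * (ε / 2) ^ 3) * volume.real T ≤
      (∫ Q in T, (dist (P + t • u) Q)⁻¹) - ∫ Q in T, (dist P Q)⁻¹ := by
  have : Nontrivial E := nontrivial_of_finrank_pos (R := ℝ) (by omega)
  obtain ⟨R, hRm, hR⟩ := exists_measurePreserving_reflection hu P t
  have hRinner (Q : E) : ⟪u, R Q - P⟫ = t - ⟪u, Q - P⟫ := by
    rw [hR, add_sub_right_comm, inner_add_right, real_inner_smul_right, real_inner_self_eq_norm_sq,
      hu]
    ring
  have hRR (Q : E) : R (R Q) = Q := by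
    rw [hR (R Q), hRinner, hR]
    module
  have hdist (Q : E) : dist P (R Q) = dist (P + t • u) Q := by
    rw [← sq_eq_sq₀ dist_nonneg dist_nonneg]
    have h₁ := dist_sq_sub_dist_add_smul_sq hu P Q t
    have h₂ := dist_sq_sub_dist_add_smul_sq hu P (Q + (t - 2 * ⟪u, Q - P⟫) • u)
      (t - 2 * ⟪u, Q - P⟫)
    rw [← hR, hRinner, hR, dist_add_right, ← hR] at h₂
    linarith
  have hdist' (Q : E) : dist (P + t • u) (R Q) = dist P Q := by
    rw [← hdist, hRR]
  set f : E → ℝ := fun Q ↦ (dist (P + t • u) Q)⁻¹ - (dist P Q)⁻¹ with hf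
  have hfT : IntegrableOn f T :=
    (integrableOn_inv_dist hdim _ hT.isBounded).sub (integrableOn_inv_dist hdim _ hT.isBounded)
  have hfR (Q : E) : f (R Q) = -f Q := by simp [hf, hdist, hdist']
  have hcont : Continuous fun Q : E ↦ ⟪u, Q - P⟫ := by fun_prop
  set N : Set E := T ∩ {Q | ⟪u, Q - P⟫ < t / 2} ∩ ball P ε
  set M : Set E := R ⁻¹' N with hM
  set W : Set E := T ∩ {Q | δ < ⟪u, Q - P⟫}
  have hNm : MeasurableSet N := (hT.measurableSet.inter
    (isOpen_lt hcont continuous_const).measurableSet).inter measurableSet_ball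
  have hMm : MeasurableSet M := R.measurable hNm
  have hWm : MeasurableSet W := hT.measurableSet.inter
    (isOpen_lt continuous_const hcont).measurableSet
  have hNT : N ⊆ T := fun Q hQ ↦ hQ.1.1
  have hMT : M ⊆ T := fun Q hQ ↦ by
    obtain ⟨⟨hQT, hQt⟩, hQε⟩ := hQ
    have h₀ := hpos _ hQT
    have := hε _ hQT (by simpa [dist_comm] using hQε) (t - 2 * ⟪u, R Q - P⟫)
      (by simp only [mem_ofPred_eq] at hQt; linarith) (by linarith)
    rwa [← hR, hRR] at this
  have hdisj : Disjoint N M := by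
    rw [Set.disjoint_left]
    rintro Q ⟨⟨-, h₁⟩, -⟩ ⟨⟨-, h₂⟩, -⟩
    simp only [mem_ofPred_eq, hRinner] at h₁ h₂
    linarith
  have hcancel : ∫ Q in N ∪ M, f Q = 0 := by
    rw [setIntegral_union hdisj hMm (hfT.mono_set hNT) (hfT.mono_set hMT)]
    have h := hRm.setIntegral_preimage_emb R.measurableEmbedding f N
    simp only [hfR, integral_neg] at h
    rw [hM]
    linarith
  set X : Set E := T \ (N ∪ M) with hX
  have hXm : MeasurableSet X := hT.measurableSet.diff (hNm.union hMm)
  have hWX : W ⊆ X := by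
    rintro Q ⟨hQT, hQδ⟩
    simp only [mem_ofPred_eq] at hQδ
    refine ⟨hQT, ?_⟩
    rintro (⟨⟨-, h⟩, -⟩ | ⟨⟨h, -⟩, -⟩)
    · simp only [mem_ofPred_eq] at h
      linarith
    · have := hpos _ h
      rw [hRinner] at this
      linarith
  have hXT : volume.real X ≤ volume.real T :=
    measureReal_mono sdiff_subset hT.measure_ne_top
  have hXtop : volume X ≠ ⊤ := ((measure_mono sdiff_subset).trans_lt hT.measure_lt_top).ne
  have hWint : IntegrableOn (fun Q ↦ W.indicator (fun _ ↦ t * δ / (2 * D ^ 3)) Q) X :=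
    (integrableOn_const hXtop).indicator hWm
  have hCint : IntegrableOn (fun _ : E ↦ t ^ 2 / (2 * (ε / 2) ^ 3)) X := integrableOn_const hXtop
  have hC : 0 ≤ t ^ 2 / (2 * (ε / 2) ^ 3) := by
    have : 0 < ε := by linarith
    positivity
  have hle : ∫ Q in X, (W.indicator (fun _ ↦ t * δ / (2 * D ^ 3)) Q - t ^ 2 / (2 * (ε / 2) ^ 3)) ≤
      ∫ Q in X, f Q := by
    refine setIntegral_mono_on_ae (hWint.sub hCint) (hfT.mono_set sdiff_subset) hXm ?_
    filter_upwards [compl_mem_ae_iff.2 (measure_singleton (P + t • u))] with Q hQne hQX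
    have hQa : 0 < dist (P + t • u) Q := dist_pos.2 (Ne.symm hQne)
    have hsq := dist_sq_sub_dist_add_smul_sq hu P Q t
    have hQy := inner_le_dist_of_norm_eq_one hu P Q
    have hQ₀ := hpos _ hQX.1
    by_cases hQW : Q ∈ W
    · rw [indicator_of_mem hQW]
      have hδ : δ < ⟪u, Q - P⟫ := hQW.2
      have : t * δ / (2 * D ^ 3) ≤ f Q :=
        div_le_inv_sub_inv hQa (by linarith) (hD' _ hQX.1) (hD _ hQX.1) (by nlinarith)
          (by rw [hsq]; gcongr; linarith)
      linarith
    · rw [indicator_of_notMem hQW, zero_sub]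
      by_cases hQt : ⟪u, Q - P⟫ < t / 2
      · have hQε : ε ≤ dist P Q := by
          by_contra! h
          exact hQX.2 (.inl ⟨⟨hQX.1, hQt⟩, by simpa [dist_comm] using h⟩)
        have htri : dist P Q ≤ t + dist (P + t • u) Q := by
          refine (dist_triangle P (P + t • u) Q).trans_eq ?_
          simp [norm_smul, hu, abs_of_pos ht]
        refine neg_div_le_inv_sub_inv (by linarith) (by linarith) (by linarith) (sq_nonneg t) ?_
        rw [hsq]
        nlinarith
      · push Not at hQt
        have : dist (P + t • u) Q ≤ dist P Q := by
          rw [← sq_le_sq₀ dist_nonneg dist_nonneg]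
          nlinarith
        have : (dist P Q)⁻¹ ≤ (dist (P + t • u) Q)⁻¹ := inv_anti₀ hQa this
        simp only [hf]
        linarith
  rw [integral_sub hWint hCint, setIntegral_indicator hWm, inter_eq_right.2 hWX, setIntegral_const,
    setIntegral_const, smul_eq_mul, smul_eq_mul] at hle
  have htot : ∫ Q in T, f Q = ∫ Q in X, f Q := by
    have := setIntegral_sdiff (hNm.union hMm) hfT (union_subset hNT hMT)
    rw [hX, this, hcancel, sub_zero]
  rw [← integral_sub (integrableOn_inv_dist hdim _ hT.isBounded)
    (integrableOn_inv_dist hdim _ hT.isBounded)]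
  have := mul_le_mul_of_nonneg_left hXT hC
  calc _ ≤ ∫ Q in X, f Q := by linarith
    _ = _ := htot.symm

lemma exists_pos_measureReal_inter_lt_inner {T : Set E} (hT : IsCompact T)
    (hTi : (interior T).Nonempty) {P u : E} (hu : ‖u‖ = 1) (hpos : ∀ Q ∈ T, 0 ≤ ⟪u, Q - P⟫) :
    ∃ δ > 0, 0 < volume.real (T ∩ {Q | δ < ⟪u, Q - P⟫}) := by
  obtain ⟨Q, hQ⟩ := hTi
  have hlim : Filter.Tendsto (fun s : ℝ ↦ Q + s • u) (𝓝[>] 0) (𝓝 Q) := by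
    have : Continuous fun s : ℝ ↦ Q + s • u := by fun_prop
    simpa using (this.tendsto 0).mono_left nhdsWithin_le_nhds
  obtain ⟨s, hsT, hs : (0 : ℝ) < s⟩ :=
    ((hlim.eventually (isOpen_interior.mem_nhds hQ)).and self_mem_nhdsWithin).exists
  refine ⟨s / 2, half_pos hs, ?_⟩
  have hopen : IsOpen (interior T ∩ {Q | s / 2 < ⟪u, Q - P⟫}) :=
    isOpen_interior.inter (isOpen_lt continuous_const (by fun_prop))
  have hmem : Q + s • u ∈ interior T ∩ {Q | s / 2 < ⟪u, Q - P⟫} := by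
    refine ⟨hsT, ?_⟩
    have := hpos Q (interior_subset hQ)
    simp only [mem_ofPred_eq]
    rw [add_sub_right_comm, inner_add_right, real_inner_smul_right, real_inner_self_eq_norm_sq, hu]
    linarith
  refine ENNReal.toReal_pos ?_ ((measure_mono inter_subset_left).trans_lt hT.measure_lt_top).ne
  exact ((hopen.measure_pos volume ⟨_, hmem⟩).trans_le
    (measure_mono (inter_subset_inter_left _ interior_subset))).ne'

/-- If `u` is an inner normal of a supporting hyperplane of `T` at `P` and `T` is stable near `P`
under small translations along `u`, then the potential increases from `P` in the direction `u`. -/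
lemma not_isLocalMax_setIntegral_inv_dist (hdim : 2 ≤ finrank ℝ E) {T : Set E} (hT : IsCompact T)
    (hTi : (interior T).Nonempty) {P u : E} (hu : ‖u‖ = 1) (hpos : ∀ Q ∈ T, 0 ≤ ⟪u, Q - P⟫)
    {ε : ℝ} (hε₀ : 0 < ε) (hε : ∀ Q ∈ T, dist P Q < ε → ∀ s, 0 ≤ s → s ≤ ε → Q + s • u ∈ T) :
    ¬ IsLocalMax (fun P ↦ ∫ Q in T, (dist P Q)⁻¹) P := by
  intro hmax
  obtain ⟨δ, hδ, hvol⟩ := exists_pos_measureReal_inter_lt_inner hT hTi hu hpos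
  obtain ⟨r, hr⟩ := hT.isBounded.subset_closedBall P
  set D := max r 0 + 1 with hDdef
  have hD₀ : 0 < D := by positivity
  set c := δ / (2 * D ^ 3) * volume.real (T ∩ {Q | δ < ⟪u, Q - P⟫}) with hc
  have hc₀ : 0 < c := by positivity
  set C := 1 / (2 * (ε / 2) ^ 3) * volume.real T with hC
  have hlim : Filter.Tendsto (fun t : ℝ ↦ P + t • u) (𝓝[>] 0) (𝓝 P) := by
    have : Continuous fun t : ℝ ↦ P + t • u := by fun_prop
    simpa using (this.tendsto 0).mono_left nhdsWithin_le_nhds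
  have hsmall : ∀ᶠ t : ℝ in 𝓝[>] 0, t * C < c := by
    have : Continuous fun t : ℝ ↦ t * C := by fun_prop
    exact ((this.tendsto 0).mono_left nhdsWithin_le_nhds).eventually_lt_const (by simpa using hc₀)
  have hlt {a : ℝ} (ha : 0 < a) : ∀ᶠ t : ℝ in 𝓝[>] 0, t ≤ a :=
    nhdsWithin_le_nhds (Iic_mem_nhds ha)
  obtain ⟨t, htmax, htC, htε, htδ, ht1, ht : 0 < t⟩ :=
    ((hlim.eventually hmax).and (hsmall.and ((hlt (half_pos hε₀)).and ((hlt hδ).and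
      ((hlt one_pos).and self_mem_nhdsWithin))))).exists
  have hD (Q : E) (hQ : Q ∈ T) : dist P Q + 1 ≤ D := by
    have h₁ : dist P Q ≤ r := by simpa [dist_comm] using hr hQ
    have h₂ := le_max_left r 0
    linarith
  have hD' (Q : E) (hQ : Q ∈ T) : dist (P + t • u) Q ≤ D := by
    have h₁ := dist_triangle (P + t • u) P Q
    have h₂ : dist (P + t • u) P = t := by simp [norm_smul, hu, abs_of_pos ht]
    have h₃ := hD Q hQ
    linarith
  have key := le_setIntegral_inv_dist_sub hdim hT hu hpos hε ht htε htδ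
    (fun Q hQ ↦ by linarith [hD Q hQ]) hD'
  have hfac : t * δ / (2 * D ^ 3) * volume.real (T ∩ {Q | δ < ⟪u, Q - P⟫})
      - t ^ 2 / (2 * (ε / 2) ^ 3) * volume.real T = t * (c - t * C) := by
    rw [hc, hC]
    ring
  rw [hfac] at key
  have := mul_pos ht (sub_pos.2 htC)
  linarith

end Measure

section Triangle

variable {ι : Type*}

lemma AffineBasis.coord_add_smul (b : AffineBasis ι ℝ E) (i : ι) (Q u : E) (s : ℝ) :
    b.coord i (Q + s • u) = b.coord i Q + s * (b.coord i).linear u := by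
  have := (b.coord i).map_vadd Q (s • u)
  rw [vadd_eq_add, vadd_eq_add, map_smul, smul_eq_mul] at this
  rw [add_comm Q, this, add_comm]

lemma AffineBasis.linear_coord_sub (b : AffineBasis ι ℝ E) (i : ι) (P Q : E) :
    (b.coord i).linear (Q - P) = b.coord i Q - b.coord i P := by
  simpa using (b.coord i).linearMap_vsub Q P

lemma AffineBasis.exists_add_smul_mem_convexHull [Finite ι] [FiniteDimensional ℝ E]
    (b : AffineBasis ι ℝ E) {P u : E} (hu : ∀ i, b.coord i P = 0 → 0 ≤ (b.coord i).linear u) :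
    ∃ ε > 0, ∀ Q ∈ convexHull ℝ (range b), dist P Q < ε → ∀ s, 0 ≤ s → s ≤ ε →
      Q + s • u ∈ convexHull ℝ (range b) := by
  have hev : ∀ᶠ x : E × ℝ in 𝓝 (P, 0), ∀ i, 0 ≤ b.coord i x.1 → 0 ≤ x.2 →
      0 ≤ b.coord i (x.1 + x.2 • u) := by
    refine Filter.eventually_all.2 fun i ↦ ?_
    have hcont : Continuous (b.coord i) := continuous_barycentric_coord b i
    have hc₁ : Continuous fun x : E × ℝ ↦ b.coord i x.1 := by fun_prop
    have hc₂ : Continuous fun x : E × ℝ ↦ b.coord i (x.1 + x.2 • u) := by fun_prop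
    rcases lt_trichotomy (b.coord i P) 0 with h | h | h
    · filter_upwards [(hc₁.tendsto (P, 0)).eventually_lt_const h] with x hx hx'
      linarith
    · refine .of_forall fun x hx hx' ↦ ?_
      rw [b.coord_add_smul]
      exact add_nonneg hx (mul_nonneg hx' (hu i h))
    · filter_upwards [(hc₂.tendsto (P, 0)).eventually_const_lt (u := 0) (by simpa using h)]
        with x hx _ _ using hx.le
  obtain ⟨ε, hε, h⟩ := Metric.eventually_nhds_iff.1 hev
  refine ⟨ε / 2, half_pos hε, fun Q hQ hPQ s hs hsε ↦ ?_⟩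
  rw [b.convexHull_eq_nonneg_coord] at hQ ⊢
  refine fun i ↦ h (y := (Q, s)) ?_ i (hQ i) hs
  rw [Prod.dist_eq, max_lt_iff, dist_comm, Real.dist_eq, sub_zero, abs_of_nonneg hs]
  constructor <;> linarith

lemma inner_normalize_add_normalize_nonneg (v w : E) : 0 ≤ ⟪‖v‖⁻¹ • v + ‖w‖⁻¹ • w, v⟫ := by
  rcases eq_or_ne w 0 with rfl | hw
  · simp only [smul_zero, add_zero, real_inner_smul_left]
    exact mul_nonneg (by positivity) real_inner_self_nonneg
  have h₁ : ‖v‖⁻¹ * ‖v‖ ^ 2 = ‖v‖ := by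
    rcases eq_or_ne v 0 with rfl | hv
    · simp
    · field_simp
  have h₂ : -‖v‖ ≤ ‖w‖⁻¹ * ⟪w, v⟫ := by
    have := neg_le_of_abs_le (abs_real_inner_le_norm w v)
    rw [inv_mul_eq_div, le_div_iff₀ (norm_pos_iff.2 hw)]
    linarith
  rw [inner_add_left, real_inner_smul_left, real_inner_smul_left, real_inner_self_eq_norm_sq, h₁]
  linarith

/-- At a vertex take the bisector of the angle, inside an edge take the inner normal. -/
lemma AffineBasis.exists_inner_nonneg_of_notMem_interior [FiniteDimensional ℝ E]
    (b : AffineBasis (Fin 3) ℝ E) {P : E} (hP : P ∈ convexHull ℝ (range b))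
    (hPi : P ∉ interior (convexHull ℝ (range b))) :
    ∃ u ≠ (0 : E), (∀ Q ∈ convexHull ℝ (range b), 0 ≤ ⟪u, Q - P⟫) ∧
      ∀ i, b.coord i P = 0 → 0 ≤ (b.coord i).linear u := by
  rw [b.convexHull_eq_nonneg_coord] at hP
  rw [b.interior_convexHull] at hPi
  simp only [mem_ofPred_eq, not_forall, not_lt] at hPi hP
  obtain ⟨i, hi⟩ := hPi
  have hi₀ : b.coord i P = 0 := le_antisymm hi (hP i)
  by_cases h : ∃ j ≠ i, b.coord j P = 0
  · obtain ⟨j, hji, hj₀⟩ := h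
    obtain ⟨k, hki, hkj, hcases⟩ : ∃ k, k ≠ i ∧ k ≠ j ∧ ∀ l, l = i ∨ l = j ∨ l = k := by
      have : ∀ i j : Fin 3, j ≠ i → ∃ k, k ≠ i ∧ k ≠ j ∧ ∀ l, l = i ∨ l = j ∨ l = k := by decide
      exact this i j hji
    have hk₁ : b.coord k P = 1 := by
      rw [← b.sum_coord_apply_eq_one P, Finset.sum_eq_single k]
      · rintro l - hlk
        rcases hcases l with rfl | rfl | rfl
        exacts [hi₀, hj₀, absurd rfl hlk]
      · simp
    obtain rfl : P = b k := by
      refine b.ext_elem fun l ↦ ?_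
      rcases hcases l with rfl | rfl | rfl
      · rw [hi₀, b.coord_apply_ne hki.symm]
      · rw [hj₀, b.coord_apply_ne hkj.symm]
      · rw [hk₁, b.coord_apply_eq]
    set v := b i - b k with hv
    set w := b j - b k with hw
    have hlin (l : Fin 3) : (b.coord l).linear (‖v‖⁻¹ • v + ‖w‖⁻¹ • w) =
        ‖v‖⁻¹ * (b.coord l (b i) - b.coord l (b k)) +
          ‖w‖⁻¹ * (b.coord l (b j) - b.coord l (b k)) := by
      rw [map_add, map_smul, map_smul, hv, hw, b.linear_coord_sub, b.linear_coord_sub, smul_eq_mul,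
        smul_eq_mul]
    have hv₀ : v ≠ 0 := sub_ne_zero.2 (b.ind.injective.ne hki.symm)
    refine ⟨‖v‖⁻¹ • v + ‖w‖⁻¹ • w, fun h₀ ↦ ?_, fun Q hQ ↦ ?_, fun l hl ↦ ?_⟩
    · have := hlin i
      rw [h₀, map_zero, b.coord_apply_eq, b.coord_apply_ne hki.symm,
        b.coord_apply_ne hji.symm] at this
      simp only [sub_zero, sub_self, mul_one, mul_zero, add_zero] at this
      exact inv_ne_zero (norm_ne_zero_iff.2 hv₀) this.symm
    · have hconv : Convex ℝ {x | ⟪‖v‖⁻¹ • v + ‖w‖⁻¹ • w, b k⟫ ≤ ⟪‖v‖⁻¹ • v + ‖w‖⁻¹ • w, x⟫} :=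
        convex_halfSpace_ge (innerₗ E (‖v‖⁻¹ • v + ‖w‖⁻¹ • w)).isLinear _
      have hsub : range b ⊆ {x | ⟪‖v‖⁻¹ • v + ‖w‖⁻¹ • w, b k⟫ ≤ ⟪‖v‖⁻¹ • v + ‖w‖⁻¹ • w, x⟫} := by
        rintro _ ⟨l, rfl⟩
        rw [mem_ofPred_eq, ← sub_nonneg, ← inner_sub_right]
        rcases hcases l with rfl | rfl | rfl
        · exact inner_normalize_add_normalize_nonneg v w
        · rw [add_comm]
          exact inner_normalize_add_normalize_nonneg w v
        · simp
      rw [inner_sub_right, sub_nonneg]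
      exact convexHull_min hsub hconv hQ
    · rw [hlin, hl, sub_zero, sub_zero]
      have hnonneg (m : Fin 3) : 0 ≤ b.coord l (b m) := by
        rw [b.coord_apply]
        split_ifs <;> norm_num
      exact add_nonneg (mul_nonneg (by positivity) (hnonneg i))
        (mul_nonneg (by positivity) (hnonneg j))
  · push Not at h
    let φ := (b.coord i).linear.toContinuousLinearMap
    have hφ (v : E) : ⟪(InnerProductSpace.toDual ℝ E).symm φ, v⟫ = (b.coord i).linear v := by
      simp [φ]
    refine ⟨(InnerProductSpace.toDual ℝ E).symm φ, ?_, fun Q hQ ↦ ?_, fun j hj ↦ ?_⟩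
    · intro h₀
      have := hφ (b i - P)
      rw [h₀, inner_zero_left, b.linear_coord_sub, b.coord_apply_eq, hi₀] at this
      norm_num at this
    · rw [b.convexHull_eq_nonneg_coord] at hQ
      rw [hφ, b.linear_coord_sub, hi₀, sub_zero]
      exact hQ i
    · obtain rfl : j = i := by
        by_contra hne
        exact h j hne hj
      rw [← hφ]
      exact real_inner_self_nonneg

lemma AffineBasis.exists_unit_inner_nonneg_add_smul_mem [FiniteDimensional ℝ E]
    (b : AffineBasis (Fin 3) ℝ E) {P : E} (hPi : P ∉ interior (convexHull ℝ (range b))) :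
    ∃ u : E, ‖u‖ = 1 ∧ (∀ Q ∈ convexHull ℝ (range b), 0 ≤ ⟪u, Q - P⟫) ∧
      ∃ ε > 0, ∀ Q ∈ convexHull ℝ (range b), dist P Q < ε → ∀ s, 0 ≤ s → s ≤ ε →
        Q + s • u ∈ convexHull ℝ (range b) := by
  by_cases hP : P ∈ convexHull ℝ (range b)
  · obtain ⟨u, hu, hinner, hlin⟩ := b.exists_inner_nonneg_of_notMem_interior hP hPi
    refine ⟨‖u‖⁻¹ • u, norm_smul_inv_norm hu, fun Q hQ ↦ ?_,
      b.exists_add_smul_mem_convexHull fun i hi ↦ ?_⟩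
    · rw [real_inner_smul_left]
      exact mul_nonneg (by positivity) (hinner Q hQ)
    · rw [map_smul, smul_eq_mul]
      exact mul_nonneg (by positivity) (hlin i hi)
  · have hclosed : IsClosed (convexHull ℝ (range b)) :=
      ((finite_range b).isCompact_convexHull (𝕜 := ℝ)).isClosed
    obtain ⟨f, c, hfP, hf⟩ := geometric_hahn_banach_point_closed (convex_convexHull ℝ _) hclosed hP
    obtain ⟨ε, hε, hball⟩ := Metric.isOpen_iff.1 hclosed.isOpen_compl P hP
    set u := (InnerProductSpace.toDual ℝ E).symm f with hu
    have hinner (Q : E) (hQ : Q ∈ convexHull ℝ (range b)) : 0 < ⟪u, Q - P⟫ := by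
      rw [hu, InnerProductSpace.toDual_symm_apply, map_sub]
      linarith [hf Q hQ]
    have hu₀ : u ≠ 0 := by
      intro h₀
      have := hinner (b 0) (subset_convexHull ℝ _ (mem_range_self 0))
      simp [h₀] at this
    refine ⟨‖u‖⁻¹ • u, norm_smul_inv_norm hu₀, fun Q hQ ↦ ?_, ε, hε, fun Q hQ hQε ↦ ?_⟩
    · rw [real_inner_smul_left]
      exact mul_nonneg (by positivity) (hinner Q hQ).le
    · exact absurd hQ (hball (by simpa [dist_comm] using hQε))

end Triangle

end Potential

theorem potential_local_max_interior
    (A B C : EuclideanSpace ℝ (Fin 2))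
    (hABC : AffineIndependent ℝ ![A, B, C])
    (T : Set (EuclideanSpace ℝ (Fin 2)))
    (hT : T = convexHull ℝ {A, B, C})
    (V : EuclideanSpace ℝ (Fin 2) → ℝ)
    (hV : ∀ P, V P = ∫ Q in T, (dist P Q)⁻¹ ∂volume)
    (P : EuclideanSpace ℝ (Fin 2)) (hP : IsLocalMax V P) :
    P ∈ interior T := by
  have hspan : affineSpan ℝ (Set.range ![A, B, C]) = ⊤ :=
    hABC.affineSpan_eq_top_iff_card_eq_finrank_add_one.2 (by simp)
  let b : AffineBasis (Fin 3) ℝ (EuclideanSpace ℝ (Fin 2)) := ⟨![A, B, C], hABC, hspan⟩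
  have hTb : T = convexHull ℝ (Set.range b) := by
    rw [hT]
    congr 1
    change _ = Set.range ![A, B, C]
    simp only [Matrix.range_cons, Matrix.range_empty, Set.union_empty, Set.singleton_union]
  obtain rfl : V = fun P ↦ ∫ Q in T, (dist P Q)⁻¹ := funext hV
  by_contra hPi
  rw [hTb] at hPi
  obtain ⟨u, hu, hpos, ε, hε₀, hε⟩ := b.exists_unit_inner_nonneg_add_smul_mem hPi
  rw [← hTb] at hpos hε
  refine not_isLocalMax_setIntegral_inv_dist (by simp) ?_ ?_ hu hpos hε₀ hε hP
  · rw [hTb]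
    exact (Set.finite_range b).isCompact_convexHull (𝕜 := ℝ)
  · rw [hTb]
    exact ⟨_, b.centroid_mem_interior_convexHull⟩
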